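/- (Chebyshev guarantee.) For every ε > 0, every integer n ≥ 1, and every real k > 0, the probability that the estimated value deviates from n by at least kεn is at most 1/k²: Σ_{l ∈ ℕ, |A_ε(l) − n| ≥ kεn} Q_l(n) ≤ 1/k². -/

import Mathlib

/-- The optimal estimation function `A_ε(l) = ((1+2ε²)^l − 1)(1+ε²)/(2ε²)`. -/
noncomputable def A (ε : ℝ) (l : ℕ) : ℝ :=
  ((1 + 2 * ε ^ 2) ^ l - 1) / (2 * ε ^ 2) * (1 + ε ^ 2)

/-- `D_ε(l) = A_ε(l+1) − A_ε(l)`. -/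
noncomputable def D (ε : ℝ) (l : ℕ) : ℝ := A ε (l + 1) - A ε l

/-- `Q ε n l` is the probability `Q_l(n)` that the counter's symbol equals `l`
after `n` packet arrivals, for the process that starts at symbol `0` and on
each arrival increments the current symbol `l` to `l+1` with probability
`1/D_ε(l)`. -/
noncomputable def Q (ε : ℝ) : ℕ → ℕ → ℝ
  | 0, 0 => 1
  | 0, _ + 1 => 0
  | n + 1, 0 => Q ε n 0 * (1 - 1 / D ε 0)
  | n + 1, l + 1 => Q ε n (l + 1) * (1 - 1 / D ε (l + 1)) + Q ε n l / D ε l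

lemma Q_eq_zero_of_lt (ε : ℝ) (n : ℕ) : ∀ l, n < l → Q ε n l = 0 := by
  induction n with
  | zero =>
    intro l hl
    obtain ⟨m, rfl⟩ := Nat.exists_eq_succ_of_ne_zero hl.ne'
    simp [Q]
  | succ n ih =>
    intro l hl
    obtain ⟨m, rfl⟩ := Nat.exists_eq_succ_of_ne_zero (Nat.ne_zero_of_lt hl)
    simp [Q, ih (m + 1) (by omega), ih m (by omega)]

lemma D_eq (ε : ℝ) (hε : 0 < ε) (l : ℕ) : D ε l = (1 + 2 * ε ^ 2) ^ l * (1 + ε ^ 2) := by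
  unfold D A
  field_simp
  ring

lemma D_eq_affine_A (ε : ℝ) (hε : 0 < ε) (l : ℕ) :
    D ε l = 1 + ε ^ 2 + 2 * ε ^ 2 * A ε l := by
  rw [D_eq ε hε]
  unfold A
  field_simp
  ring

lemma one_le_D (ε : ℝ) (hε : 0 < ε) (l : ℕ) : 1 ≤ D ε l := by
  rw [D_eq ε hε]
  exact one_le_mul_of_one_le_of_one_le
    (one_le_pow₀ (by nlinarith [sq_nonneg ε])) (by nlinarith [sq_nonneg ε])

lemma Q_nonneg (ε : ℝ) (hε : 0 < ε) (n : ℕ) : ∀ l, 0 ≤ Q ε n l := by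
  have hD : ∀ l, 0 ≤ 1 - 1 / D ε l := fun l => by
    have h := one_le_D ε hε l
    rw [sub_nonneg, div_le_one (by linarith)]
    exact h
  induction n with
  | zero =>
    intro l
    cases l <;> simp [Q]
  | succ n ih =>
    intro l
    cases l with
    | zero =>
      rw [Q]
      exact mul_nonneg (ih 0) (hD 0)
    | succ l =>
      rw [Q]
      exact add_nonneg (mul_nonneg (ih _) (hD _))
        (div_nonneg (ih l) (zero_le_one.trans (one_le_D ε hε l)))

/-- The one-step evolution of expectations of functions of the symbol. -/
lemma sum_Q_succ_mul (ε : ℝ) (n : ℕ) (f : ℕ → ℝ) :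
    ∑ l ∈ Finset.range (n + 2), Q ε (n + 1) l * f l =
      ∑ l ∈ Finset.range (n + 1), Q ε n l * (f l + (f (l + 1) - f l) / D ε l) := by
  have h : ∑ l ∈ Finset.range (n + 2), Q ε n l * (1 - 1 / D ε l) * f l =
      ∑ l ∈ Finset.range (n + 1), Q ε n l * (1 - 1 / D ε l) * f l := by
    rw [Finset.sum_range_succ _ (n + 1), Q_eq_zero_of_lt ε n (n + 1) (Nat.lt_succ_self n)]
    ring
  rw [Finset.sum_range_succ'] at h ⊢
  simp only [Q, add_mul, Finset.sum_add_distrib]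
  rw [add_right_comm, h, ← Finset.sum_add_distrib]
  exact Finset.sum_congr rfl fun l _ => by ring

lemma sum_Q (ε : ℝ) (n : ℕ) : ∑ l ∈ Finset.range (n + 1), Q ε n l = 1 := by
  induction n with
  | zero => simp [Q]
  | succ n ih => simpa [ih] using sum_Q_succ_mul ε n fun _ => 1

lemma sum_Q_mul_A (ε : ℝ) (hε : 0 < ε) (n : ℕ) :
    ∑ l ∈ Finset.range (n + 1), Q ε n l * A ε l = n := by
  induction n with
  | zero => simp [Q, A]
  | succ n ih =>
    have h : ∀ l, A ε l + (A ε (l + 1) - A ε l) / D ε l = A ε l + 1 := fun l => by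
      rw [← D, div_self (by linarith [one_le_D ε hε l])]
    rw [sum_Q_succ_mul]
    simp only [h, mul_add, mul_one, Finset.sum_add_distrib, ih, sum_Q]
    push_cast
    ring

lemma sum_Q_mul_A_sq (ε : ℝ) (hε : 0 < ε) (n : ℕ) :
    ∑ l ∈ Finset.range (n + 1), Q ε n l * A ε l ^ 2 = (1 + ε ^ 2) * n ^ 2 := by
  induction n with
  | zero => simp [Q, A]
  | succ n ih =>
    have h : ∀ l, Q ε n l * (A ε l ^ 2 + (A ε (l + 1) ^ 2 - A ε l ^ 2) / D ε l) =
        Q ε n l * A ε l ^ 2 + (2 * (1 + ε ^ 2)) * (Q ε n l * A ε l)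
          + (1 + ε ^ 2) * Q ε n l := fun l => by
      have hA : A ε (l + 1) = A ε l + D ε l := by unfold D; ring
      have hD : D ε l ≠ 0 := by linarith [one_le_D ε hε l]
      have hq : (A ε (l + 1) ^ 2 - A ε l ^ 2) / D ε l = 2 * A ε l + D ε l := by
        rw [hA]
        field_simp
        ring
      rw [hq, D_eq_affine_A ε hε]
      ring
    rw [sum_Q_succ_mul]
    simp only [h, Finset.sum_add_distrib, ← Finset.mul_sum, ih, sum_Q, sum_Q_mul_A ε hε]
    push_cast
    ring

lemma sum_Q_mul_sub_sq (ε : ℝ) (hε : 0 < ε) (n : ℕ) :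
    ∑ l ∈ Finset.range (n + 1), Q ε n l * (A ε l - n) ^ 2 = ε ^ 2 * n ^ 2 := by
  have h : ∀ l, Q ε n l * (A ε l - n) ^ 2 =
      Q ε n l * A ε l ^ 2 - 2 * n * (Q ε n l * A ε l) + n ^ 2 * Q ε n l := fun l => by ring
  simp only [h, Finset.sum_add_distrib, Finset.sum_sub_distrib, ← Finset.mul_sum,
    sum_Q, sum_Q_mul_A ε hε, sum_Q_mul_A_sq ε hε]
  ring

/-- Chebyshev guarantee: for every `ε > 0`, integer `n ≥ 1`
and real `k > 0`, the probability that the estimated value deviates from `n`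
by at least `kεn` is at most `1/k²`:
`Σ_{l : |A_ε(l) − n| ≥ kεn} Q_l(n) ≤ 1/k²`. -/
theorem chebyshev_guarantee (ε : ℝ) (hε : ε > 0) (n : ℕ) (hn : 1 ≤ n)
    (k : ℝ) (hk : 0 < k) :
    (∑' l : ℕ, if k * ε * n ≤ |A ε l - n| then Q ε n l else 0) ≤ 1 / k ^ 2 := by
  have hn' : (0 : ℝ) < n := by exact_mod_cast hn
  have hc : 0 < k * ε * n := by positivity
  rw [tsum_eq_sum (s := Finset.range (n + 1)) fun l hl => by
    rw [Q_eq_zero_of_lt ε n l (by simpa [Nat.succ_le_iff] using hl), ite_self]]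
  calc ∑ l ∈ Finset.range (n + 1), (if k * ε * n ≤ |A ε l - n| then Q ε n l else 0)
      ≤ ∑ l ∈ Finset.range (n + 1), Q ε n l * (A ε l - n) ^ 2 / (k * ε * n) ^ 2 := by
        refine Finset.sum_le_sum fun l _ => ?_
        have hQ := Q_nonneg ε hε n l
        split_ifs with h
        · rw [le_div_iff₀ (by positivity), ← sq_abs (A ε l - n)]
          gcongr
        · positivity
    _ = 1 / k ^ 2 := by
        rw [← Finset.sum_div, sum_Q_mul_sub_sq ε hε]
        field_simp
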